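/- arXiv:2502.07558 — 4 statements merged into one kernel-verified Lean document; each statement's English description precedes it below -/
import Mathlib

section
/- (Hodge decomposition.) Let A be a real n×p matrix and B a real p×m matrix with A B = 0. Then ℝ^p decomposes as the orthogonal direct sum ℝ^p = range(Aᵀ) ⊕ ker(AᵀA + BBᵀ) ⊕ range(B); i.e., these three subspaces are pairwise orthogonal and their sum is all of ℝ^p. -/
open Matrix

/-- The kernel of the Hodge Laplacian consists of the vectors killed by both `A` and `Bᵀ`. -/
theorem mem_ker_hodgeLaplacian_iff {ι κ μ : Type*} [Fintype ι] [Fintype κ] [Fintype μ]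
    (A : Matrix ι κ ℝ) (B : Matrix κ μ ℝ) (x : κ → ℝ) :
    x ∈ LinearMap.ker (Aᵀ * A + B * Bᵀ).mulVecLin ↔ A *ᵥ x = 0 ∧ Bᵀ *ᵥ x = 0 := by
  rw [LinearMap.mem_ker, mulVecLin_apply, add_mulVec, ← mulVec_mulVec, ← mulVec_mulVec]
  refine ⟨fun h => ?_, fun ⟨hA, hB⟩ => by simp [hA, hB]⟩
  have hsum : (A *ᵥ x) ⬝ᵥ (A *ᵥ x) + (Bᵀ *ᵥ x) ⬝ᵥ (Bᵀ *ᵥ x) = 0 := by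
    rw [dotProduct_mulVec (A *ᵥ x), ← mulVec_transpose, dotProduct_mulVec (Bᵀ *ᵥ x),
      ← mulVec_transpose, transpose_transpose, ← add_dotProduct, h, zero_dotProduct]
  have hA : 0 ≤ (A *ᵥ x) ⬝ᵥ (A *ᵥ x) := Finset.sum_nonneg fun _ _ => mul_self_nonneg _
  have hB : 0 ≤ (Bᵀ *ᵥ x) ⬝ᵥ (Bᵀ *ᵥ x) := Finset.sum_nonneg fun _ _ => mul_self_nonneg _
  exact ⟨dotProduct_self_eq_zero.mp (by linarith), dotProduct_self_eq_zero.mp (by linarith)⟩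

/-- The range and the kernel of a real symmetric matrix span the whole space. -/
theorem Matrix.IsSymm.range_sup_ker_eq_top {κ : Type*} [Fintype κ] {L : Matrix κ κ ℝ}
    (hL : L.IsSymm) :
    LinearMap.range L.mulVecLin ⊔ LinearMap.ker L.mulVecLin = ⊤ := by
  refine Submodule.eq_top_of_disjoint _ _ (LinearMap.finrank_range_add_finrank_ker _).ge ?_
  rw [Submodule.disjoint_def]
  rintro _ ⟨x, rfl⟩ hx
  rw [LinearMap.mem_ker, mulVecLin_apply, mulVecLin_apply] at hx
  rw [mulVecLin_apply, ← dotProduct_self_eq_zero, dotProduct_mulVec, ← mulVec_transpose, hL.eq,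
    hx, zero_dotProduct]

/-- **Hodge decomposition.** If `A B = 0`, then `ℝ^p` is the orthogonal direct sum
`range(Aᵀ) ⊕ ker(AᵀA + BBᵀ) ⊕ range(B)`: the three subspaces are pairwise orthogonal
(w.r.t. the standard inner product, i.e. the dot product) and their sum is all of `ℝ^p`. -/
theorem stmt_3 (n p m : ℕ)
    (A : Matrix (Fin n) (Fin p) ℝ) (B : Matrix (Fin p) (Fin m) ℝ)
    (hAB : A * B = 0) :
    (∀ x ∈ LinearMap.range Aᵀ.mulVecLin,
      ∀ y ∈ LinearMap.ker (Aᵀ * A + B * Bᵀ).mulVecLin, x ⬝ᵥ y = 0) ∧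
    (∀ x ∈ LinearMap.range Aᵀ.mulVecLin,
      ∀ y ∈ LinearMap.range B.mulVecLin, x ⬝ᵥ y = 0) ∧
    (∀ x ∈ LinearMap.ker (Aᵀ * A + B * Bᵀ).mulVecLin,
      ∀ y ∈ LinearMap.range B.mulVecLin, x ⬝ᵥ y = 0) ∧
    LinearMap.range Aᵀ.mulVecLin ⊔ LinearMap.ker (Aᵀ * A + B * Bᵀ).mulVecLin ⊔
      LinearMap.range B.mulVecLin = ⊤ := by
  refine ⟨?_, ?_, ?_, ?_⟩
  · rintro _ ⟨u, rfl⟩ y hy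
    rw [mulVecLin_apply, mulVec_transpose, ← dotProduct_mulVec,
      ((mem_ker_hodgeLaplacian_iff A B y).mp hy).1, dotProduct_zero]
  · rintro _ ⟨u, rfl⟩ _ ⟨v, rfl⟩
    rw [mulVecLin_apply, mulVecLin_apply, mulVec_transpose, ← dotProduct_mulVec, mulVec_mulVec,
      hAB, zero_mulVec, dotProduct_zero]
  · rintro x hx _ ⟨v, rfl⟩
    rw [mulVecLin_apply, dotProduct_mulVec, ← mulVec_transpose,
      ((mem_ker_hodgeLaplacian_iff A B x).mp hx).2, zero_dotProduct]
  · have hL : (Aᵀ * A + B * Bᵀ).IsSymm := by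
      simp only [IsSymm, transpose_add, transpose_mul, transpose_transpose]
    rw [eq_top_iff, ← hL.range_sup_ker_eq_top, sup_right_comm]
    refine sup_le_sup_right ?_ _
    rintro _ ⟨x, rfl⟩
    rw [mulVecLin_apply, add_mulVec, ← mulVec_mulVec, ← mulVec_mulVec]
    exact Submodule.add_mem_sup ⟨_, rfl⟩ ⟨_, rfl⟩
end

section
/- Let A be a real n×p matrix and B a real p×m matrix with A B = 0. Then ker(Bᵀ) decomposes as the orthogonal direct sum ker(Bᵀ) = range(Aᵀ) ⊕ (ker(A) ∩ ker(Bᵀ)), and ker(A) decomposes as the orthogonal direct sum ker(A) = (ker(A) ∩ ker(Bᵀ)) ⊕ range(B). -/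
open Matrix

theorem Matrix.dotProduct_eq_zero_of_mem_range_transpose_of_mem_ker {ι κ : Type*}
    [Fintype ι] [Fintype κ] {C : Matrix ι κ ℝ} {x y : κ → ℝ}
    (hx : x ∈ LinearMap.range Cᵀ.mulVecLin) (hy : y ∈ LinearMap.ker C.mulVecLin) :
    x ⬝ᵥ y = 0 := by
  obtain ⟨u, rfl⟩ := hx
  rw [LinearMap.mem_ker, mulVecLin_apply] at hy
  rw [mulVecLin_apply, mulVec_transpose, ← dotProduct_mulVec, hy, dotProduct_zero]

theorem Matrix.range_transpose_sup_ker {ι κ : Type*} [Fintype ι] [Fintype κ]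
    (C : Matrix ι κ ℝ) :
    LinearMap.range Cᵀ.mulVecLin ⊔ LinearMap.ker C.mulVecLin = ⊤ := by
  refine Submodule.eq_top_of_disjoint _ _ ?_ ?_
  · have h := C.mulVecLin.finrank_range_add_finrank_ker
    have hr : Module.finrank ℝ (LinearMap.range Cᵀ.mulVecLin) =
        Module.finrank ℝ (LinearMap.range C.mulVecLin) := C.rank_transpose
    rw [hr, h]
  · rw [Submodule.disjoint_def]
    intro x hx hy
    exact dotProduct_self_eq_zero.mp
      (dotProduct_eq_zero_of_mem_range_transpose_of_mem_ker hx hy)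

theorem Matrix.range_mulVecLin_le_ker {ι κ μ : Type*} [Fintype κ] [Fintype μ]
    {C : Matrix ι κ ℝ} {D : Matrix κ μ ℝ} (h : C * D = 0) :
    LinearMap.range D.mulVecLin ≤ LinearMap.ker C.mulVecLin := by
  rintro _ ⟨u, rfl⟩
  rw [LinearMap.mem_ker, mulVecLin_apply, mulVecLin_apply, mulVec_mulVec, h, zero_mulVec]

/-- **Orthogonal decompositions of `ker(Bᵀ)` and `ker(A)`.**
If `A B = 0`, then `ker(Bᵀ) = range(Aᵀ) ⊕ (ker(A) ∩ ker(Bᵀ))` and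
`ker(A) = (ker(A) ∩ ker(Bᵀ)) ⊕ range(B)`, both orthogonal direct sums with
respect to the standard inner product on `ℝ^p`. -/
theorem stmt_5 (n p m : ℕ)
    (A : Matrix (Fin n) (Fin p) ℝ) (B : Matrix (Fin p) (Fin m) ℝ)
    (hAB : A * B = 0) :
    (LinearMap.range Aᵀ.mulVecLin ⊔
        (LinearMap.ker A.mulVecLin ⊓ LinearMap.ker Bᵀ.mulVecLin)
      = LinearMap.ker Bᵀ.mulVecLin) ∧
    (∀ x ∈ LinearMap.range Aᵀ.mulVecLin,
      ∀ y ∈ LinearMap.ker A.mulVecLin ⊓ LinearMap.ker Bᵀ.mulVecLin, x ⬝ᵥ y = 0) ∧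
    ((LinearMap.ker A.mulVecLin ⊓ LinearMap.ker Bᵀ.mulVecLin) ⊔
        LinearMap.range B.mulVecLin
      = LinearMap.ker A.mulVecLin) ∧
    (∀ x ∈ LinearMap.ker A.mulVecLin ⊓ LinearMap.ker Bᵀ.mulVecLin,
      ∀ y ∈ LinearMap.range B.mulVecLin, x ⬝ᵥ y = 0) := by
  have hBA : Bᵀ * Aᵀ = 0 := by rw [← transpose_mul, hAB, transpose_zero]
  have hB := Bᵀ.range_transpose_sup_ker
  rw [transpose_transpose] at hB
  refine ⟨?_, fun x hx y hy => ?_, ?_, fun x hx y hy => ?_⟩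
  · rw [← sup_inf_assoc_of_le _ (range_mulVecLin_le_ker hBA), A.range_transpose_sup_ker,
      top_inf_eq]
  · exact dotProduct_eq_zero_of_mem_range_transpose_of_mem_ker hx hy.1
  · rw [sup_comm, inf_comm, ← sup_inf_assoc_of_le _ (range_mulVecLin_le_ker hAB), hB, top_inf_eq]
  · rw [dotProduct_comm]
    refine dotProduct_eq_zero_of_mem_range_transpose_of_mem_ker ?_ hx.2
    rwa [transpose_transpose]
end

section
/- Let A be a real n×p matrix and B a real p×m matrix with A B = 0. Then p = rank(A) + dim ker(AᵀA + BBᵀ) + rank(B). Equivalently, the rank of the up-boundary B equals the number of middle-dimensional simplices minus the Betti number minus the rank of the down-boundary: rank(B) = p − β − rank(A), where β = dim ker(AᵀA + BBᵀ). -/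
open Matrix

theorem ker_mulVecLin_hodgeLaplacian {l m n : Type*} [Fintype l] [Fintype m] [Fintype n]
    (A : Matrix l m ℝ) (B : Matrix m n ℝ) :
    LinearMap.ker (Aᵀ * A + B * Bᵀ).mulVecLin =
      LinearMap.ker A.mulVecLin ⊓ LinearMap.ker Bᵀ.mulVecLin := by
  have h : Aᵀ * A + B * Bᵀ = (fromRows A Bᵀ)ᵀ * fromRows A Bᵀ := by
    rw [transpose_fromRows, fromCols_mul_fromRows, transpose_transpose]
  rw [h, ker_mulVecLin_transpose_mul_self]
  ext x
  simp only [LinearMap.mem_ker, mulVecLin_apply, fromRows_mulVec, Submodule.mem_inf]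
  rw [← Sum.elim_zero_zero, Sum.elim_eq_iff]

theorem map_mulVecLin_transpose_ker_eq_range {l m n : Type*} [Fintype m] [Fintype n]
    (A : Matrix l m ℝ) (B : Matrix m n ℝ) (hAB : A * B = 0) :
    (LinearMap.ker A.mulVecLin).map Bᵀ.mulVecLin = LinearMap.range Bᵀ.mulVecLin := by
  refine le_antisymm LinearMap.map_le_range ?_
  have hle : LinearMap.range (Bᵀ * B).mulVecLin ≤ LinearMap.range Bᵀ.mulVecLin := by
    rw [mulVecLin_mul]
    exact LinearMap.range_comp_le_range _ _
  have heq := Submodule.eq_of_le_of_finrank_eq hle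
    ((rank_transpose_mul_self B).trans (rank_transpose B).symm)
  rw [← heq]
  rintro _ ⟨x, rfl⟩
  refine ⟨B *ᵥ x, ?_, ?_⟩
  · simp [hAB]
  · simp

/-- **Rank–nullity for the Hodge Laplacian.** If `A B = 0`, then
`p = rank(A) + dim ker(AᵀA + BBᵀ) + rank(B)`; equivalently,
`rank(B) = p − β − rank(A)` where `β = dim ker(AᵀA + BBᵀ)`. -/
theorem stmt_10 (n p m : ℕ)
    (A : Matrix (Fin n) (Fin p) ℝ) (B : Matrix (Fin p) (Fin m) ℝ)
    (hAB : A * B = 0) :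
    p = A.rank + Module.finrank ℝ (LinearMap.ker (Aᵀ * A + B * Bᵀ).mulVecLin) + B.rank ∧
    B.rank = p - Module.finrank ℝ (LinearMap.ker (Aᵀ * A + B * Bᵀ).mulVecLin) - A.rank := by
  have hA : A.rank + Module.finrank ℝ (LinearMap.ker A.mulVecLin) = p := by
    simpa [Matrix.rank] using A.mulVecLin.finrank_range_add_finrank_ker
  have hB := (Bᵀ.mulVecLin.domRestrict (LinearMap.ker A.mulVecLin)).finrank_range_add_finrank_ker
  have hker : Module.finrank ℝ
      (LinearMap.ker (Bᵀ.mulVecLin.domRestrict (LinearMap.ker A.mulVecLin))) =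
      Module.finrank ℝ (LinearMap.ker (Aᵀ * A + B * Bᵀ).mulVecLin) := by
    rw [ker_mulVecLin_hodgeLaplacian, ← Submodule.map_comap_subtype,
      Submodule.finrank_map_subtype_eq]
    rfl
  have hrank : Module.finrank ℝ (LinearMap.range Bᵀ.mulVecLin) = B.rank := rank_transpose B
  rw [LinearMap.range_domRestrict, map_mulVecLin_transpose_ker_eq_range A B hAB, hrank, hker] at hB
  omega
end

section
/- Let A be a real n×p matrix and B a real p×m matrix with A B = 0, and suppose the density condition p ≥ 2·(n + dim ker(AᵀA + BBᵀ)) holds. Then rank(B) ≥ p/2. In particular, for a sufficiently dense simplicial complex with m_k/2 ≥ m_{k−1} + β_k, the generalized effective resistance vector satisfies ‖r‖₁ = rank(B_{k+1}) ≥ m_k/2. -/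
open Matrix

/-- The rank of matrices is subadditive. -/
theorem rank_add_le_rank_add_rank {m n K : Type*} [Fintype m] [Fintype n] [Field K]
    (M N : Matrix m n K) : (M + N).rank ≤ M.rank + N.rank := by
  unfold Matrix.rank
  refine le_trans (Submodule.finrank_mono ?_) (Submodule.finrank_add_le_finrank_add_finrank _ _)
  rintro _ ⟨x, rfl⟩
  rw [Matrix.mulVecLin_add]
  exact Submodule.add_mem_sup ⟨x, rfl⟩ ⟨x, rfl⟩

/-- **Density lower bound on the rank of the up-boundary.**
If `A B = 0` and `p ≥ 2 (n + dim ker(AᵀA + BBᵀ))`, then `rank(B) ≥ p / 2`; in particular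
the ℓ¹-norm of the generalized effective resistance vector, which equals `rank(B)`,
is at least `p / 2`. -/
theorem stmt_13 (n p m : ℕ)
    (A : Matrix (Fin n) (Fin p) ℝ) (B : Matrix (Fin p) (Fin m) ℝ)
    (hAB : A * B = 0)
    (hdense : p ≥ 2 * (n + Module.finrank ℝ (LinearMap.ker (Aᵀ * A + B * Bᵀ).mulVecLin))) :
    (p : ℝ) / 2 ≤ (B.rank : ℝ) := by
  have hadd := rank_add_le_rank_add_rank (Aᵀ * A) (B * Bᵀ)
  have hA : (Aᵀ * A).rank ≤ n :=
    (Matrix.rank_mul_le_right _ _).trans A.rank_le_height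
  have hB : (B * Bᵀ).rank ≤ B.rank := Matrix.rank_mul_le_left _ _
  have hker := LinearMap.finrank_range_add_finrank_ker (Aᵀ * A + B * Bᵀ).mulVecLin
  rw [Module.finrank_fin_fun] at hker
  change (Aᵀ * A + B * Bᵀ).rank + _ = p at hker
  have hp : p ≤ 2 * B.rank := by omega
  have hp' : (p : ℝ) ≤ 2 * (B.rank : ℝ) := by exact_mod_cast hp
  linarith
end
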